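/- arXiv:2311.03940 — 6 statements merged into one kernel-verified Lean document; each statement's English description precedes it below -/
import Mathlib

section
/- Let k ≥ 2 and ℓ ≥ 1 be integers, let U ⊆ ℝ^ℓ × ℝ be a convex open set containing (0,0), and let p : U → ℝ be a C^∞ submersion (the differential of p is nonzero at every point of U) such that p⁻¹(0) = U ∩ (ℝ^ℓ × {0}). Then the following are equivalent: (i) for every r with 1 ≤ r ≤ k−1, the function x ↦ (∂^r p/∂y^r)(x,0) is constant on U ∩ (ℝ^ℓ × {0}); (ii) there exist real constants a₁,…,a_{k−1} with a₁ ≠ 0 and a C^∞ function f : U → ℝ such that p(x,y) = a₁y + a₂y² + … + a_{k−1}y^{k−1} + f(x,y)·y^k for all (x,y) ∈ U. Moreover, when (ii) holds, the constants a₁,…,a_{k−1} and the function f are unique. -/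
open Set Filter Topology

open scoped ContDiff

/-- Differentiation under the integral sign for a smooth integrand. -/
lemma hasFDerivAt_intervalIntegral_of_contDiffOn {E F : Type*}
    [NormedAddCommGroup E] [NormedSpace ℝ E] [FiniteDimensional ℝ E]
    [NormedAddCommGroup F] [NormedSpace ℝ F] {V : Set (E × ℝ)} (hV : IsOpen V)
    {W : Set E} (hW : IsOpen W) (hWV : ∀ z ∈ W, ∀ t ∈ Icc (0 : ℝ) 1, (z, t) ∈ V)
    {G : E × ℝ → F} (hG : ContDiffOn ℝ ∞ G V) {z : E} (hz : z ∈ W) :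
    HasFDerivAt (fun z => ∫ t in (0 : ℝ)..1, G (z, t))
      (∫ t in (0 : ℝ)..1, (fderiv ℝ G (z, t)).comp (ContinuousLinearMap.inl ℝ E ℝ)) z := by
  have hG' : ContinuousOn
      (fun w => (fderiv ℝ G w).comp (ContinuousLinearMap.inl ℝ E ℝ)) V :=
    (hG.continuousOn_fderiv_of_isOpen hV (by simp)).clm_comp continuousOn_const
  obtain ⟨ε, hε, hball⟩ := Metric.nhds_basis_closedBall.mem_iff.1 (hW.mem_nhds hz)
  have hslice : ∀ x ∈ W, ContinuousOn (fun t : ℝ => ((x, t) : E × ℝ)) (uIcc 0 1) :=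
    fun x _ => by fun_prop
  have hmaps : ∀ x ∈ W, MapsTo (fun t : ℝ => ((x, t) : E × ℝ)) (uIcc 0 1) V := by
    intro x hx t ht
    rw [uIcc_of_le zero_le_one] at ht
    exact hWV x hx t ht
  obtain ⟨C, hC⟩ := ((isCompact_closedBall z ε).prod
    (isCompact_Icc (a := (0 : ℝ)) (b := 1))).exists_bound_of_continuousOn
      (hG'.mono fun w hw => hWV w.1 (hball hw.1) w.2 hw.2)
  have hint : ∀ x ∈ W, IntervalIntegrable (fun t => G (x, t)) MeasureTheory.volume 0 1 :=
    fun x hx => (hG.continuousOn.comp (hslice x hx) (hmaps x hx)).intervalIntegrable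
  refine intervalIntegral.hasFDerivAt_integral_of_dominated_of_fderiv_le
    (F := fun x t => G (x, t)) (bound := fun _ => C)
    (F' := fun x t => (fderiv ℝ G (x, t)).comp (ContinuousLinearMap.inl ℝ E ℝ))
    (Metric.closedBall_mem_nhds z hε) ?_ (hint z hz) ?_ ?_ (by simp) ?_
  · filter_upwards [hW.mem_nhds hz] with x hx
    exact (hint x hx).aestronglyMeasurable_restrict_uIoc
  · exact (hG'.comp (hslice z hz) (hmaps z hz)).intervalIntegrable
      |>.aestronglyMeasurable_restrict_uIoc
  · refine Eventually.of_forall fun t ht x hx => hC (x, t) ⟨hx, ?_⟩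
    exact uIcc_of_le (zero_le_one' ℝ) ▸ uIoc_subset_uIcc ht
  · refine Eventually.of_forall fun t ht x hx => ?_
    have hxt : (x, t) ∈ V := hmaps x (hball hx) (uIoc_subset_uIcc ht)
    have hd : HasFDerivAt G (fderiv ℝ G (x, t)) (x, t) :=
      ((hG.contDiffAt (hV.mem_nhds hxt)).differentiableAt (by simp)).hasFDerivAt
    exact hd.comp x (hasFDerivAt_prodMk_left x t)

/-- The integral of a smooth function over a compact interval depends smoothly on parameters. -/
lemma contDiffOn_intervalIntegral {E F : Type}
    [NormedAddCommGroup E] [NormedSpace ℝ E] [FiniteDimensional ℝ E]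
    [NormedAddCommGroup F] [NormedSpace ℝ F] {V : Set (E × ℝ)} (hV : IsOpen V)
    {W : Set E} (hW : IsOpen W) (hWV : ∀ z ∈ W, ∀ t ∈ Icc (0 : ℝ) 1, (z, t) ∈ V)
    {G : E × ℝ → F} (hG : ContDiffOn ℝ ∞ G V) :
    ContDiffOn ℝ ∞ (fun z => ∫ t in (0 : ℝ)..1, G (z, t)) W := by
  refine contDiffOn_infty.2 fun n => ?_
  induction n generalizing F with
  | zero =>
    exact contDiffOn_zero.2 fun z hz =>
      (hasFDerivAt_intervalIntegral_of_contDiffOn hV hW hWV hG hz).continuousAt.continuousWithinAt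
  | succ n ih =>
    have hd := fun z hz => hasFDerivAt_intervalIntegral_of_contDiffOn hV hW hWV hG (z := z) hz
    rw [Nat.cast_succ, contDiffOn_succ_iff_fderiv_of_isOpen hW]
    refine ⟨fun z hz => (hd z hz).differentiableAt.differentiableWithinAt, by simp, ?_⟩
    refine ContDiffOn.congr (ih (G := fun w =>
      (fderiv ℝ G w).comp (ContinuousLinearMap.inl ℝ E ℝ)) ?_) fun z hz => (hd z hz).fderiv
    exact (hG.fderiv_of_isOpen hV (by simp)).clm_comp contDiffOn_const

/-- **Hadamard's lemma** with parameters, in the last variable. -/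
lemma exists_contDiffOn_eq_add_snd_mul {E : Type}
    [NormedAddCommGroup E] [NormedSpace ℝ E] [FiniteDimensional ℝ E]
    {W : Set (E × ℝ)} (hW : IsOpen W)
    (hstar : ∀ z ∈ W, ∀ t ∈ Icc (0 : ℝ) 1, (z.1, t * z.2) ∈ W)
    {g : E × ℝ → ℝ} (hg : ContDiffOn ℝ ∞ g W) :
    ∃ h : E × ℝ → ℝ, ContDiffOn ℝ ∞ h W ∧ ∀ z ∈ W, g z = g (z.1, 0) + h z * z.2 := by
  set m : (E × ℝ) × ℝ → E × ℝ := fun w => (w.1.1, w.2 * w.1.2) with hm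
  have hmd : ContDiff ℝ ∞ m := by fun_prop
  have hdg : ContDiffOn ℝ ∞ (fun z => fderiv ℝ g z (0, 1)) W :=
    (hg.fderiv_of_isOpen hW (by simp)).clm_apply contDiffOn_const
  refine ⟨fun z => ∫ t in (0 : ℝ)..1, fderiv ℝ g (m (z, t)) (0, 1),
    contDiffOn_intervalIntegral (hW.preimage hmd.continuous) hW hstar
      (hdg.comp hmd.contDiffOn fun _ hw => hw), fun z hz => ?_⟩
  have hmem : ∀ t ∈ uIcc (0 : ℝ) 1, m (z, t) ∈ W := fun t ht =>
    hstar z hz t (uIcc_of_le (zero_le_one' ℝ) ▸ ht)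
  have hderiv : ∀ t ∈ uIcc (0 : ℝ) 1,
      HasDerivAt (fun t => g (m (z, t))) (fderiv ℝ g (m (z, t)) (0, 1) * z.2) t := by
    intro t ht
    have hd : HasFDerivAt g (fderiv ℝ g (m (z, t))) (m (z, t)) :=
      ((hg.contDiffAt (hW.mem_nhds (hmem t ht))).differentiableAt (by simp)).hasFDerivAt
    have hc : HasDerivAt (fun t : ℝ => m (z, t)) (z.2 • ((0 : E), (1 : ℝ))) t := by
      simpa using (hasDerivAt_const t z.1).prodMk ((hasDerivAt_id t).mul_const z.2)
    have := hd.comp_hasDerivAt t hc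
    rwa [map_smul, smul_eq_mul, mul_comm] at this
  have hcont : ContinuousOn (fun t : ℝ => fderiv ℝ g (m (z, t)) (0, 1) * z.2) (uIcc 0 1) :=
    (hdg.continuousOn.comp (by fun_prop) hmem).mul continuousOn_const
  have hftc := intervalIntegral.integral_eq_sub_of_hasDerivAt hderiv hcont.intervalIntegrable
  rw [intervalIntegral.integral_mul_const] at hftc
  simp only [hm, one_mul, zero_mul] at hftc ⊢
  linarith

/-- Taylor expansion in the last variable with smooth remainder. -/
lemma exists_contDiffOn_eq_sum_add_mul_pow {E : Type}
    [NormedAddCommGroup E] [NormedSpace ℝ E] [FiniteDimensional ℝ E]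
    {W : Set (E × ℝ)} (hW : IsOpen W)
    (hstar : ∀ z ∈ W, ∀ t ∈ Icc (0 : ℝ) 1, (z.1, t * z.2) ∈ W)
    {g : E × ℝ → ℝ} (hg : ContDiffOn ℝ ∞ g W) (k : ℕ) :
    ∃ (c : ℕ → E → ℝ) (h : E × ℝ → ℝ), ContDiffOn ℝ ∞ h W ∧
      ∀ z ∈ W, g z = (∑ i ∈ Finset.range k, c i z.1 * z.2 ^ i) + h z * z.2 ^ k := by
  induction k with
  | zero => exact ⟨0, g, hg, by simp⟩
  | succ k ih =>
    obtain ⟨c, h, hh, hgh⟩ := ih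
    obtain ⟨h', hh', hhh'⟩ := exists_contDiffOn_eq_add_snd_mul hW hstar hh
    refine ⟨Function.update c k fun x => h (x, 0), h', hh', fun z hz => ?_⟩
    have hsum : ∀ i ∈ Finset.range k,
        Function.update c k (fun x => h (x, 0)) i z.1 * z.2 ^ i = c i z.1 * z.2 ^ i := by
      intro i hi
      rw [Function.update_of_ne (Finset.mem_range.1 hi).ne]
    rw [Finset.sum_range_succ, Finset.sum_congr rfl hsum, Function.update_self, hgh z hz,
      hhh' z hz]
    ring

/-- The derivatives at `0` of order less than `k` of a polynomial plus a smooth multiple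
of `y ^ k`. -/
lemma iteratedDeriv_zero_of_eq_sum_add_mul_pow {q h : ℝ → ℝ} {s : Finset ℕ} {c : ℕ → ℝ}
    {k r : ℕ} (hr : r < k) (hrs : r ∈ s) (hh : ContDiffAt ℝ ∞ h 0)
    (hq : ∀ᶠ y in 𝓝 (0 : ℝ), q y = (∑ i ∈ s, c i * y ^ i) + h y * y ^ k) :
    iteratedDeriv r q 0 = c r * r.factorial := by
  have hh' : ContDiffAt ℝ r h 0 := hh.of_le (by exact_mod_cast le_top)
  rw [Filter.EventuallyEq.iteratedDeriv_eq r hq, iteratedDeriv_fun_add (by fun_prop) (by fun_prop),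
    iteratedDeriv_fun_sum (fun i _ => by fun_prop), iteratedDeriv_fun_mul hh' (by fun_prop)]
  have hrem : ∀ i ∈ Finset.range (r + 1), (r.choose i : ℝ) * iteratedDeriv i h 0 *
      iteratedDeriv (r - i) (fun y : ℝ => y ^ k) 0 = 0 := by
    intro i _
    rw [iteratedDeriv_fun_pow_zero, if_neg (by omega), Nat.cast_zero, mul_zero]
  rw [Finset.sum_eq_zero hrem, add_zero]
  simp [iteratedDeriv_const_mul_field, iteratedDeriv_fun_pow_zero, hrs,
    -iteratedDeriv_pow]

/-- A smooth function on an open set restricts to a smooth function on vertical lines. -/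
lemma contDiffAt_comp_prodMk_left {E : Type*} [NormedAddCommGroup E] [NormedSpace ℝ E]
    {U : Set (E × ℝ)} (hU : IsOpen U) {f : E × ℝ → ℝ} (hf : ContDiffOn ℝ ∞ f U)
    {x : E} {y : ℝ} (hx : (x, y) ∈ U) : ContDiffAt ℝ ∞ (fun y => f (x, y)) y :=
  ContDiffAt.comp y (hf.contDiffAt (hU.mem_nhds hx)) (by fun_prop)

lemma eventually_prodMk_mem {E : Type*} [TopologicalSpace E]
    {U : Set (E × ℝ)} (hU : IsOpen U) {x : E} {y₀ : ℝ} (hx : (x, y₀) ∈ U) :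
    ∀ᶠ y in 𝓝 y₀, (x, y) ∈ U :=
  (hU.preimage (Continuous.prodMk_right x)).mem_nhds hx

/-- The coefficients of an expansion `∑ aᵢ yⁱ + f(x, y) yᵏ` are the Taylor coefficients. -/
lemma iteratedDeriv_eq_of_expansion {E : Type*} [NormedAddCommGroup E] [NormedSpace ℝ E]
    {U : Set (E × ℝ)} (hU : IsOpen U) {p f : E × ℝ → ℝ} (hf : ContDiffOn ℝ ∞ f U)
    {s : Finset ℕ} {c : ℕ → E → ℝ} {k r : ℕ} (hr : r < k) (hrs : r ∈ s)
    (hp : ∀ z ∈ U, p z = (∑ i ∈ s, c i z.1 * z.2 ^ i) + f z * z.2 ^ k)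
    {x : E} (hx : (x, (0 : ℝ)) ∈ U) :
    iteratedDeriv r (fun y => p (x, y)) 0 = c r x * r.factorial :=
  iteratedDeriv_zero_of_eq_sum_add_mul_pow (c := fun i => c i x) hr hrs
    (contDiffAt_comp_prodMk_left hU hf hx)
    ((eventually_prodMk_mem hU hx).mono fun _ hy => hp _ hy)

/-- A submersion vanishing on the hyperplane `y = 0` has nonzero `y`-derivative there. -/
lemma deriv_ne_zero_of_fderiv_ne_zero {E : Type*} [NormedAddCommGroup E] [NormedSpace ℝ E]
    {p : E × ℝ → ℝ} {x : E} (hp : DifferentiableAt ℝ p (x, 0)) (hne : fderiv ℝ p (x, 0) ≠ 0)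
    (hzero : ∀ᶠ x' in 𝓝 x, p (x', 0) = 0) : deriv (fun y => p (x, y)) 0 ≠ 0 := by
  intro hd
  apply hne
  have hx : (fderiv ℝ p (x, 0)).comp (ContinuousLinearMap.inl ℝ E ℝ) = 0 :=
    (hp.hasFDerivAt.comp x (hasFDerivAt_prodMk_left x (0 : ℝ))).unique
      ((hasFDerivAt_const (0 : ℝ) x).congr_of_eventuallyEq hzero)
  have hy : (fderiv ℝ p (x, 0)) (0, 1) = 0 := by
    have hc : HasDerivAt (fun y : ℝ => (x, y)) ((0 : E), (1 : ℝ)) 0 :=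
      (hasDerivAt_const (0 : ℝ) x).prodMk (hasDerivAt_id (0 : ℝ))
    exact (hp.hasFDerivAt.comp_hasDerivAt (0 : ℝ) hc).deriv.symm.trans hd
  ext v
  · simpa using DFunLike.congr_fun hx v
  · simpa using hy

/-- Functions continuous on an open set which agree off the hyperplane `y = 0` are equal. -/
lemma eqOn_of_eqOn_snd_ne_zero {E : Type*} [TopologicalSpace E]
    {U : Set (E × ℝ)} (hU : IsOpen U) {f f' : E × ℝ → ℝ} (hf : ContinuousOn f U)
    (hf' : ContinuousOn f' U) (h : ∀ z ∈ U, z.2 ≠ 0 → f z = f' z) : EqOn f f' U := by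
  rintro ⟨x, y⟩ hz
  have hl : Tendsto (fun t : ℝ => (x, t)) (𝓝[≠] y) (𝓝 (x, y)) :=
    ((Continuous.prodMk_right x).tendsto y).mono_left nhdsWithin_le_nhds
  by_cases hy : y = 0
  · subst hy
    refine tendsto_nhds_unique_of_eventuallyEq
      ((hf.continuousAt (hU.mem_nhds hz)).tendsto.comp hl)
      ((hf'.continuousAt (hU.mem_nhds hz)).tendsto.comp hl) ?_
    filter_upwards [self_mem_nhdsWithin,
      nhdsWithin_le_nhds (eventually_prodMk_mem hU hz)] with t ht htU
    exact h _ htU ht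
  · exact h _ hz hy

/-- Taylor expansion with constant coefficients and smooth remainder on a convex open set. -/
lemma exists_contDiffOn_remainder {E : Type}
    [NormedAddCommGroup E] [NormedSpace ℝ E] [FiniteDimensional ℝ E]
    {U : Set (E × ℝ)} (hU : IsOpen U) (hconv : Convex ℝ U) {p : E × ℝ → ℝ}
    (hp : ContDiffOn ℝ ∞ p U) {k : ℕ} {a : ℕ → ℝ}
    (ha : ∀ r < k, ∀ x, (x, (0 : ℝ)) ∈ U →
      iteratedDeriv r (fun y => p (x, y)) 0 = a r * r.factorial) :
    ∃ f : E × ℝ → ℝ, ContDiffOn ℝ ∞ f U ∧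
      ∀ z ∈ U, p z = (∑ i ∈ Finset.range k, a i * z.2 ^ i) + f z * z.2 ^ k := by
  classical
  set W : Set (E × ℝ) := U ∩ {z | (z.1, (0 : ℝ)) ∈ U}
  have hW : IsOpen W := hU.inter (hU.preimage (continuous_fst.prodMk continuous_const))
  have hstar : ∀ z ∈ W, ∀ t ∈ Icc (0 : ℝ) 1, (z.1, t * z.2) ∈ W := by
    rintro ⟨x, y⟩ ⟨hz, hz0⟩ t ht
    refine ⟨?_, hz0⟩
    have := hconv hz0 hz (sub_nonneg.2 ht.2) ht.1 (by ring)
    convert this using 1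
    ext
    · simp [← add_smul]
    · simp
  obtain ⟨c, h, hh, hph⟩ :=
    exists_contDiffOn_eq_sum_add_mul_pow hW hstar (hp.mono inter_subset_left) k
  have hca : ∀ z ∈ W, ∀ i ∈ Finset.range k, c i z.1 = a i := by
    intro z hz i hi
    have hi' := Finset.mem_range.1 hi
    have h1 := iteratedDeriv_eq_of_expansion hW hh hi' hi hph (x := z.1) ⟨hz.2, hz.2⟩
    rw [ha i hi' z.1 hz.2] at h1
    exact (mul_right_cancel₀ (by positivity) h1).symm
  have hpW : ∀ z ∈ W, p z = (∑ i ∈ Finset.range k, a i * z.2 ^ i) + h z * z.2 ^ k := by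
    intro z hz
    rw [hph z hz, Finset.sum_congr rfl fun i hi => by rw [hca z hz i hi]]
  set Q : E × ℝ → ℝ := fun z => (p z - ∑ i ∈ Finset.range k, a i * z.2 ^ i) / z.2 ^ k with hQ
  have hQh : ∀ z ∈ W, z.2 ≠ 0 → Q z = h z := by
    intro z hz hz2
    rw [hQ]
    simp only [hpW z hz]
    field_simp
    ring
  set f : E × ℝ → ℝ := fun z => if z.2 = 0 then h z else Q z with hf
  refine ⟨f, fun z hz => ContDiffAt.contDiffWithinAt ?_, fun z hz => ?_⟩
  · by_cases hz2 : z.2 = 0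
    · have hzW : z ∈ W := ⟨hz, by rw [mem_ofPred_eq, ← hz2]; exact hz⟩
      refine (hh.contDiffAt (hW.mem_nhds hzW)).congr_of_eventuallyEq ?_
      filter_upwards [hW.mem_nhds hzW] with w hw
      by_cases hw2 : w.2 = 0
      · simp [hf, hw2]
      · simp [hf, hw2, hQh w hw hw2]
    · have hQd : ContDiffAt ℝ ∞ Q z := by
        have hpz := hp.contDiffAt (hU.mem_nhds hz)
        exact (hpz.sub (by fun_prop)).div (by fun_prop) (pow_ne_zero _ hz2)
      refine hQd.congr_of_eventuallyEq ?_
      filter_upwards [(isOpen_ne.preimage continuous_snd).mem_nhds hz2] with w hw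
      exact if_neg hw
  · by_cases hz2 : z.2 = 0
    · have hzW : z ∈ W := ⟨hz, by rw [mem_ofPred_eq, ← hz2]; exact hz⟩
      rw [hf, hpW z hzW]
      simp only [if_pos hz2]
    · simp only [hf, if_neg hz2, hQ]
      field_simp
      ring


/-- Let `k ≥ 2`, `ℓ ≥ 1`, let `U ⊆ ℝ^ℓ × ℝ` be a convex open set containing
`(0,0)` and let `p : U → ℝ` be a smooth submersion with `p⁻¹(0) = U ∩ (ℝ^ℓ × {0})`.  Then the
constancy along `U ∩ (ℝ^ℓ × {0})` of the partial derivatives `∂^r p/∂y^r`, `1 ≤ r ≤ k-1`, is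
equivalent to a representation `p(x,y) = a₁y + … + a_{k-1}y^{k-1} + f(x,y)y^k` with `a₁ ≠ 0` and
`f` smooth; moreover such a representation is unique. -/
theorem statement0 (k ℓ : ℕ) (hk : 2 ≤ k) (hℓ : 1 ≤ ℓ)
    (U : Set ((Fin ℓ → ℝ) × ℝ)) (hUopen : IsOpen U) (hUconv : Convex ℝ U)
    (hU0 : ((0 : Fin ℓ → ℝ), (0 : ℝ)) ∈ U)
    (p : (Fin ℓ → ℝ) × ℝ → ℝ)
    (hp : ContDiffOn ℝ (⊤ : ℕ∞) p U)
    (hsubmersion : ∀ z ∈ U, fderiv ℝ p z ≠ 0)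
    (hzero : ∀ z ∈ U, (p z = 0 ↔ z.2 = 0)) :
    ((∀ r : ℕ, 1 ≤ r → r ≤ k - 1 →
        ∀ x x' : Fin ℓ → ℝ, (x, (0 : ℝ)) ∈ U → (x', (0 : ℝ)) ∈ U →
          iteratedDeriv r (fun y : ℝ => p (x, y)) 0
            = iteratedDeriv r (fun y : ℝ => p (x', y)) 0) ↔
      (∃ (a : ℕ → ℝ) (f : (Fin ℓ → ℝ) × ℝ → ℝ),
        a 1 ≠ 0 ∧ ContDiffOn ℝ (⊤ : ℕ∞) f U ∧
        ∀ z ∈ U, p z = (∑ i ∈ Finset.Icc 1 (k - 1), a i * z.2 ^ i) + f z * z.2 ^ k))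
    ∧
    (∀ (a a' : ℕ → ℝ) (f f' : (Fin ℓ → ℝ) × ℝ → ℝ),
      ContDiffOn ℝ (⊤ : ℕ∞) f U → ContDiffOn ℝ (⊤ : ℕ∞) f' U →
      (∀ z ∈ U, p z = (∑ i ∈ Finset.Icc 1 (k - 1), a i * z.2 ^ i) + f z * z.2 ^ k) →
      (∀ z ∈ U, p z = (∑ i ∈ Finset.Icc 1 (k - 1), a' i * z.2 ^ i) + f' z * z.2 ^ k) →
      ((∀ i ∈ Finset.Icc 1 (k - 1), a i = a' i) ∧ ∀ z ∈ U, f z = f' z)) := by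
  have coeff : ∀ (a : ℕ → ℝ) (f : (Fin ℓ → ℝ) × ℝ → ℝ), ContDiffOn ℝ (⊤ : ℕ∞) f U →
      (∀ z ∈ U, p z = (∑ i ∈ Finset.Icc 1 (k - 1), a i * z.2 ^ i) + f z * z.2 ^ k) →
      ∀ r ∈ Finset.Icc 1 (k - 1), ∀ x, (x, (0 : ℝ)) ∈ U →
        iteratedDeriv r (fun y : ℝ => p (x, y)) 0 = a r * r.factorial := by
    intro a f hf hpf r hr x hx
    have hr' := Finset.mem_Icc.1 hr
    exact iteratedDeriv_eq_of_expansion hUopen hf (c := fun i _ => a i) (by omega) hr hpf hx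
  refine ⟨⟨fun hconst => ?_, ?_⟩, ?_⟩
  · set a : ℕ → ℝ := fun r =>
      iteratedDeriv r (fun y : ℝ => p ((0 : Fin ℓ → ℝ), y)) 0 / r.factorial with ha
    have hmul : ∀ r, a r * r.factorial =
        iteratedDeriv r (fun y : ℝ => p ((0 : Fin ℓ → ℝ), y)) 0 :=
      fun r => div_mul_cancel₀ _ (by positivity)
    obtain ⟨f, hf, hpf⟩ := exists_contDiffOn_remainder hUopen hUconv hp (k := k) (a := a) (by
      intro r hr x hx
      rw [hmul]
      rcases Nat.eq_zero_or_pos r with rfl | hr0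
      · simp [(hzero _ hx).2 rfl, (hzero _ hU0).2 rfl]
      · exact hconst r hr0 (by omega) x 0 hx hU0)
    refine ⟨a, f, ?_, hf, fun z hz => ?_⟩
    · have hd : deriv (fun y : ℝ => p ((0 : Fin ℓ → ℝ), y)) 0 ≠ 0 := by
        refine deriv_ne_zero_of_fderiv_ne_zero
          ((hp.contDiffAt (hUopen.mem_nhds hU0)).differentiableAt (by simp))
          (hsubmersion _ hU0) ?_
        have hmem : ∀ᶠ x in 𝓝 (0 : Fin ℓ → ℝ), (x, (0 : ℝ)) ∈ U :=
          (hUopen.preimage (Continuous.prodMk_left (0 : ℝ))).mem_nhds hU0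
        exact hmem.mono fun x hx => (hzero _ hx).2 rfl
      simpa [ha] using hd
    · have ha0 : a 0 = 0 := by simp [ha, (hzero _ hU0).2 rfl]
      have hrange : Finset.range k = insert 0 (Finset.Icc 1 (k - 1)) := by
        ext i
        simp only [Finset.mem_range, Finset.mem_insert, Finset.mem_Icc]
        omega
      rw [hpf z hz, hrange, Finset.sum_insert (by simp), ha0, zero_mul, zero_add]
  · rintro ⟨a, f, -, hf, hpf⟩ r hr1 hrk x x' hx hx'
    have hr := Finset.mem_Icc.2 ⟨hr1, hrk⟩
    rw [coeff a f hf hpf r hr x hx, coeff a f hf hpf r hr x' hx']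
  · intro a a' f f' hf hf' hpf hpf'
    have haa' : ∀ i ∈ Finset.Icc 1 (k - 1), a i = a' i := fun i hi =>
      mul_right_cancel₀ (b := (i.factorial : ℝ)) (by positivity)
        ((coeff a f hf hpf i hi 0 hU0).symm.trans (coeff a' f' hf' hpf' i hi 0 hU0))
    refine ⟨haa', eqOn_of_eqOn_snd_ne_zero hUopen hf.continuousOn hf'.continuousOn ?_⟩
    intro z hz hz2
    have h := (hpf z hz).symm.trans (hpf' z hz)
    rw [Finset.sum_congr rfl fun i hi => by rw [haa' i hi]] at h
    exact mul_right_cancel₀ (pow_ne_zero k hz2) (add_left_cancel h)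
end

section
/- Let θ : ℝⁿ → ℝⁿ be a C^∞ diffeomorphism of the form θ(x,y) = (x, v(x,y)), where v : ℝⁿ → ℝ is smooth and v(x,0) = 0 for all x ∈ ℝ^ℓ (a vertical diffeomorphism preserving the hyperplane ℝ^ℓ × {0}). Then θ_*(F^k_{ℝⁿ}) = F^k_{ℝⁿ} if and only if for each r with 1 ≤ r ≤ k−1 the function x ↦ (∂^r v/∂y^r)(x,0) is constant on ℝ^ℓ. -/
/-- The transverse order `k` foliation `F^k_{ℝⁿ}` of `ℝⁿ = ℝ^ℓ × ℝ`: smooth compactly supported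
vector fields `X` whose normal component vanishes to order `k` along the hyperplane `ℝ^ℓ × {0}`,
i.e. `(∂^r Xₙ/∂y^r)(x,0) = 0` for all `0 ≤ r ≤ k-1`. -/
def FoliationRn (ℓ k : ℕ) : Set (((Fin ℓ → ℝ) × ℝ) → ((Fin ℓ → ℝ) × ℝ)) :=
  {X | ContDiff ℝ (⊤ : ℕ∞) X ∧ HasCompactSupport X ∧
    ∀ (x : Fin ℓ → ℝ) (r : ℕ), r ≤ k - 1 →
      iteratedDeriv r (fun y : ℝ => (X (x, y)).2) 0 = 0}

open Filter Topology

/-- `f` vanishes to order `k` at the origin: `f` and its first `k - 1` derivatives are `0` there. -/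
def FlatAtZero (k : ℕ) (f : ℝ → ℝ) : Prop :=
  ∀ r < k, iteratedDeriv r f 0 = 0

namespace FlatAtZero

variable {k : ℕ} {f g h : ℝ → ℝ}

theorem succ_iff : FlatAtZero (k + 1) f ↔ f 0 = 0 ∧ FlatAtZero k (deriv f) := by
  refine ⟨fun H => ⟨by simpa using H 0 (by lia), fun r hr => ?_⟩, fun H r hr => ?_⟩
  · rw [← iteratedDeriv_succ']
    exact H (r + 1) (by lia)
  · rcases r with _ | r
    · simpa using H.1
    · rw [iteratedDeriv_succ']
      exact H.2 r (by lia)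

theorem congr (hf : FlatAtZero k f) (hfg : f =ᶠ[𝓝 0] g) : FlatAtZero k g :=
  fun r hr => by rw [← hfg.iteratedDeriv_eq r, hf r hr]

theorem add (hf : FlatAtZero k f) (hg : FlatAtZero k g) (hfs : ContDiff ℝ (⊤ : ℕ∞) f)
    (hgs : ContDiff ℝ (⊤ : ℕ∞) g) : FlatAtZero k (fun y => f y + g y) := by
  intro r hr
  rw [iteratedDeriv_fun_add ((hfs.of_le (by exact_mod_cast le_top)).contDiffAt)
    ((hgs.of_le (by exact_mod_cast le_top)).contDiffAt), hf r hr, hg r hr, add_zero]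

theorem mul_left (hg : FlatAtZero k g) (hfs : ContDiff ℝ (⊤ : ℕ∞) f)
    (hgs : ContDiff ℝ (⊤ : ℕ∞) g) : FlatAtZero k (fun y => f y * g y) := by
  intro r hr
  rw [iteratedDeriv_fun_mul ((hfs.of_le (by exact_mod_cast le_top)).contDiffAt)
    ((hgs.of_le (by exact_mod_cast le_top)).contDiffAt)]
  refine Finset.sum_eq_zero fun i _ => ?_
  rw [hg (r - i) (by lia), mul_zero]

theorem sum {ι : Type*} (s : Finset ι) {f : ι → ℝ → ℝ} (hf : ∀ i, FlatAtZero k (f i))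
    (hfs : ∀ i, ContDiff ℝ (⊤ : ℕ∞) (f i)) : FlatAtZero k (fun y => ∑ i ∈ s, f i y) := by
  intro r hr
  rw [iteratedDeriv_fun_sum fun i _ => ((hfs i).of_le (by exact_mod_cast le_top)).contDiffAt]
  exact Finset.sum_eq_zero fun i _ => hf i r hr

theorem comp (hg : FlatAtZero k g) (hgs : ContDiff ℝ (⊤ : ℕ∞) g) (hhs : ContDiff ℝ (⊤ : ℕ∞) h)
    (hh : h 0 = 0) : FlatAtZero k (fun y => g (h y)) := by
  induction k generalizing g with
  | zero => exact fun r hr => absurd hr (Nat.not_lt_zero r)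
  | succ k ih =>
    obtain ⟨hg0, hg'⟩ := succ_iff.1 hg
    have hgs' := (contDiff_infty_iff_deriv.1 hgs).2
    have hhs' := (contDiff_infty_iff_deriv.1 hhs).2
    refine succ_iff.2 ⟨by rw [hh, hg0], ?_⟩
    have hderiv : deriv (fun y => g (h y)) = fun y => deriv h y * deriv g (h y) := by
      funext y
      rw [mul_comm]
      exact deriv_comp y (hgs.differentiable (by simp) _) (hhs.differentiable (by simp) _)
    rw [hderiv]
    exact (ih hg' hgs').mul_left hhs' (hgs'.comp hhs)

end FlatAtZero

section VerticalDerivatives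

variable {E : Type*} [NormedAddCommGroup E] [NormedSpace ℝ E] {v : E × ℝ → ℝ}

theorem contDiff_fderiv_apply_const (hv : ContDiff ℝ (⊤ : ℕ∞) v) (a : E × ℝ) :
    ContDiff ℝ (⊤ : ℕ∞) (fun z => fderiv ℝ v z a) :=
  (contDiff_infty_iff_fderiv.1 hv).2.clm_apply contDiff_const

theorem deriv_vertical (hv : ContDiff ℝ (⊤ : ℕ∞) v) (x : E) :
    deriv (fun y : ℝ => v (x, y)) = fun y => fderiv ℝ v (x, y) (0, 1) := by
  funext y
  have hxy : HasDerivAt (fun y : ℝ => (x, y)) ((0 : E), (1 : ℝ)) y :=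
    (hasDerivAt_const y x).prodMk (hasDerivAt_id y)
  exact ((hv.differentiable (by simp) (x, y)).hasFDerivAt.comp_hasDerivAt y hxy).deriv

theorem contDiff_iteratedDeriv_vertical (r : ℕ) (hv : ContDiff ℝ (⊤ : ℕ∞) v) :
    ContDiff ℝ (⊤ : ℕ∞) (fun z : E × ℝ => iteratedDeriv r (fun y => v (z.1, y)) z.2) := by
  induction r generalizing v with
  | zero => simpa using hv
  | succ r ih =>
    simp only [iteratedDeriv_succ', deriv_vertical hv]
    exact ih (contDiff_fderiv_apply_const hv (0, 1))

theorem fderiv_fderiv_apply (hv : ContDiff ℝ (⊤ : ℕ∞) v) (z a b : E × ℝ) :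
    fderiv ℝ (fun z => fderiv ℝ v z a) z b = fderiv ℝ (fderiv ℝ v) z b a := by
  have hd : DifferentiableAt ℝ (fderiv ℝ v) z :=
    (contDiff_infty_iff_fderiv.1 hv).2.differentiable (by simp) z
  rw [fderiv_clm_apply hd (differentiableAt_const a)]
  simp

/-- Vertical derivatives commute with the derivative in a fixed direction. -/
theorem iteratedDeriv_fderiv_apply (r : ℕ) (hv : ContDiff ℝ (⊤ : ℕ∞) v) (a : E × ℝ) (x : E)
    (y : ℝ) :
    iteratedDeriv r (fun y => fderiv ℝ v (x, y) a) y =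
      fderiv ℝ (fun z : E × ℝ => iteratedDeriv r (fun y => v (z.1, y)) z.2) (x, y) a := by
  induction r generalizing v with
  | zero => simp
  | succ r ih =>
    simp only [iteratedDeriv_succ', deriv_vertical hv,
      deriv_vertical (contDiff_fderiv_apply_const hv a)]
    rw [← ih (contDiff_fderiv_apply_const hv (0, 1))]
    congr 1
    funext t
    rw [fderiv_fderiv_apply hv, fderiv_fderiv_apply hv]
    refine (ContDiffAt.isSymmSndFDerivAt (n := (⊤ : ℕ∞)) hv.contDiffAt ?_).eq _ _
    simp only [minSmoothness_of_isRCLikeNormedField]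
    exact WithTop.coe_le_coe.2 (le_top : (2 : ℕ∞) ≤ ⊤)

theorem iteratedDeriv_fderiv_horizontal (r : ℕ) (hv : ContDiff ℝ (⊤ : ℕ∞) v) (u x : E) :
    iteratedDeriv r (fun y => fderiv ℝ v (x, y) (u, 0)) 0 =
      fderiv ℝ (fun x => iteratedDeriv r (fun y => v (x, y)) 0) x u := by
  have hx : HasFDerivAt (fun x : E => (x, (0 : ℝ)))
      ((ContinuousLinearMap.id ℝ E).prod 0) x :=
    (hasFDerivAt_id x).prodMk (hasFDerivAt_const 0 x)
  have hcomp := ((contDiff_iteratedDeriv_vertical r hv).differentiable (by simp)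
    (x, 0)).hasFDerivAt.comp x hx
  rw [iteratedDeriv_fderiv_apply r hv]
  exact (DFunLike.congr_fun hcomp.fderiv u).symm

theorem forall_flatAtZero_fderiv_horizontal_iff {k : ℕ} (hv : ContDiff ℝ (⊤ : ℕ∞) v) :
    (∀ u x : E, FlatAtZero k (fun y => fderiv ℝ v (x, y) (u, 0))) ↔
      ∀ r < k, ∀ x x' : E,
        iteratedDeriv r (fun y => v (x, y)) 0 = iteratedDeriv r (fun y => v (x', y)) 0 := by
  constructor
  · intro H r hr
    refine is_const_of_fderiv_eq_zero (𝕜 := ℝ)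
      (f := fun x => iteratedDeriv r (fun y => v (x, y)) 0) ?_ fun x => ?_
    · exact ((contDiff_iteratedDeriv_vertical r hv).comp
        (contDiff_id.prodMk contDiff_const)).differentiable (by simp)
    · ext u
      rw [← iteratedDeriv_fderiv_horizontal r hv, H u x r hr]
      rfl
  · intro H u x r hr
    have hconst : (fun x => iteratedDeriv r (fun y => v (x, y)) 0) =
        fun _ => iteratedDeriv r (fun y => v (0, y)) 0 := funext fun x => H r hr x 0
    rw [iteratedDeriv_fderiv_horizontal r hv, hconst]
    simp

end VerticalDerivatives

theorem FlatAtZero.fderiv_horizontal {k ℓ : ℕ} {v : (Fin ℓ → ℝ) × ℝ → ℝ}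
    (hv : ContDiff ℝ (⊤ : ℕ∞) v) {x : Fin ℓ → ℝ}
    (hflat : ∀ u, FlatAtZero k (fun y => fderiv ℝ v (x, y) (u, 0)))
    {a : ℝ → Fin ℓ → ℝ} (ha : ContDiff ℝ (⊤ : ℕ∞) a) :
    FlatAtZero k (fun y => fderiv ℝ v (x, y) (a y, 0)) := by
  have hsum : (fun y => fderiv ℝ v (x, y) (a y, 0)) = fun y =>
      ∑ i, a y i * fderiv ℝ v (x, y) ((fun j => if i = j then 1 else 0 : Fin ℓ → ℝ), 0) := by
    funext y
    exact LinearMap.pi_apply_eq_sum_univ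
      ((fderiv ℝ v (x, y)).toLinearMap ∘ₗ LinearMap.inl ℝ (Fin ℓ → ℝ) ℝ) (a y)
  have hsmooth (u : Fin ℓ → ℝ) : ContDiff ℝ (⊤ : ℕ∞) (fun y => fderiv ℝ v (x, y) (u, 0)) :=
    (contDiff_fderiv_apply_const hv (u, 0)).comp (contDiff_const.prodMk contDiff_id)
  rw [hsum]
  exact FlatAtZero.sum _ (fun i => (hflat _).mul_left (contDiff_pi.1 ha i) (hsmooth _))
    fun i => (contDiff_pi.1 ha i).mul (hsmooth _)

theorem mem_foliationRn_iff {k ℓ : ℕ} (hk : 2 ≤ k)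
    {X : (Fin ℓ → ℝ) × ℝ → (Fin ℓ → ℝ) × ℝ} :
    X ∈ FoliationRn ℓ k ↔ ContDiff ℝ (⊤ : ℕ∞) X ∧ HasCompactSupport X ∧
      ∀ x, FlatAtZero k (fun y => (X (x, y)).2) := by
  refine and_congr_right fun _ => and_congr_right fun _ => forall_congr' fun x => ?_
  exact forall_congr' fun r => imp_congr_left (by lia)

section Pushforward

variable {V : Type*} [NormedAddCommGroup V] [NormedSpace ℝ V] {φ ψ X : V → V}

theorem ContDiff.pushforward (hφ : ContDiff ℝ (⊤ : ℕ∞) φ) (hψ : ContDiff ℝ (⊤ : ℕ∞) ψ)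
    (hX : ContDiff ℝ (⊤ : ℕ∞) X) :
    ContDiff ℝ (⊤ : ℕ∞) (fun z => fderiv ℝ φ (ψ z) (X (ψ z))) :=
  ((contDiff_infty_iff_fderiv.1 hφ).2.comp hψ).clm_apply (hX.comp hψ)

theorem HasCompactSupport.pushforward (hφ : Continuous φ) (hψ : Continuous ψ)
    (hli : Function.LeftInverse ψ φ) (hri : Function.RightInverse ψ φ)
    (hX : HasCompactSupport X) :
    HasCompactSupport (fun z => fderiv ℝ φ (ψ z) (X (ψ z))) := by
  let e : V ≃ₜ V := ⟨⟨ψ, φ, hri, hli⟩, hψ, hφ⟩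
  refine (hX.comp_homeomorph e).mono fun z hz hzero => hz ?_
  have hXz : X (ψ z) = 0 := hzero
  simp only [hXz, map_zero]

theorem fderiv_fderiv_of_leftInverse (hφ : Differentiable ℝ φ) (hψ : Differentiable ℝ ψ)
    (hli : Function.LeftInverse ψ φ) (z a : V) : fderiv ℝ ψ (φ z) (fderiv ℝ φ z a) = a := by
  have hcomp := (hψ (φ z)).hasFDerivAt.comp z (hφ z).hasFDerivAt
  rw [hli.comp_eq_id] at hcomp
  exact DFunLike.congr_fun (hcomp.unique (hasFDerivAt_id z)) a

end Pushforward

/-- A vertical diffeomorphism `θ(x,y) = (x, v(x,y))` of `ℝⁿ` preserving the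
hyperplane `ℝ^ℓ × {0}` satisfies `θ_*(F^k_{ℝⁿ}) = F^k_{ℝⁿ}` if and only if each of the functions
`x ↦ (∂^r v/∂y^r)(x,0)`, `1 ≤ r ≤ k-1`, is constant. -/
theorem statement1 (k ℓ : ℕ) (hk : 2 ≤ k) (hℓ : 1 ≤ ℓ)
    (v : ((Fin ℓ → ℝ) × ℝ) → ℝ) (hv : ContDiff ℝ (⊤ : ℕ∞) v)
    (hv0 : ∀ x : Fin ℓ → ℝ, v (x, 0) = 0)
    (θ θinv : ((Fin ℓ → ℝ) × ℝ) → ((Fin ℓ → ℝ) × ℝ))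
    (hθdef : ∀ z, θ z = (z.1, v z))
    (hθinv : ContDiff ℝ (⊤ : ℕ∞) θinv)
    (hli : Function.LeftInverse θinv θ) (hri : Function.RightInverse θinv θ) :
    ((fun X : ((Fin ℓ → ℝ) × ℝ) → ((Fin ℓ → ℝ) × ℝ) =>
        fun z => fderiv ℝ θ (θinv z) (X (θinv z))) '' FoliationRn ℓ k = FoliationRn ℓ k)
    ↔
    (∀ r : ℕ, 1 ≤ r → r ≤ k - 1 → ∀ x x' : Fin ℓ → ℝ,
      iteratedDeriv r (fun y : ℝ => v (x, y)) 0 = iteratedDeriv r (fun y : ℝ => v (x', y)) 0) := by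
  obtain rfl : θ = fun z => (z.1, v z) := funext hθdef
  have hθ : ContDiff ℝ (⊤ : ℕ∞) (fun z : (Fin ℓ → ℝ) × ℝ => (z.1, v z)) := contDiff_fst.prodMk hv
  have hsec (x : Fin ℓ → ℝ) : ContDiff ℝ (⊤ : ℕ∞) (fun y : ℝ => (x, y)) :=
    contDiff_const.prodMk contDiff_id
  have hvsec (x : Fin ℓ → ℝ) : ContDiff ℝ (⊤ : ℕ∞) (fun y : ℝ => v (x, y)) := hv.comp (hsec x)
  have hDθ (z a : (Fin ℓ → ℝ) × ℝ) :
      fderiv ℝ (fun z : (Fin ℓ → ℝ) × ℝ => (z.1, v z)) z a = (a.1, fderiv ℝ v z a) := by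
    have := hasFDerivAt_fst.prodMk (hv.differentiable (by simp) z).hasFDerivAt
    rw [this.fderiv]
    rfl
  have hsplit (z a : (Fin ℓ → ℝ) × ℝ) :
      fderiv ℝ v z a = fderiv ℝ v z (a.1, 0) + fderiv ℝ v z (0, 1) * a.2 := by
    rw [mul_comm, ← smul_eq_mul, ← map_smul, ← map_add]
    simp
  have hθ0 (x : Fin ℓ → ℝ) : θinv (x, 0) = (x, 0) := by
    simpa [hv0] using hli (x, 0)
  have hθ1 (z : (Fin ℓ → ℝ) × ℝ) : (θinv z).1 = z.1 := (Prod.ext_iff.1 (hri z)).1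
  have hdθ := hθ.differentiable (by simp)
  have hdθinv := hθinv.differentiable (by simp)
  have hcond : (∀ r : ℕ, 1 ≤ r → r ≤ k - 1 → ∀ x x' : Fin ℓ → ℝ,
      iteratedDeriv r (fun y : ℝ => v (x, y)) 0 = iteratedDeriv r (fun y : ℝ => v (x', y)) 0) ↔
      ∀ u x : Fin ℓ → ℝ, FlatAtZero k (fun y => fderiv ℝ v (x, y) (u, 0)) := by
    rw [forall_flatAtZero_fderiv_horizontal_iff hv]
    refine ⟨fun H r hr x x' => ?_, fun H r _ hr => H r (by lia)⟩
    rcases r with _ | r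
    · simp [hv0]
    · exact H (r + 1) (by lia) (by lia) x x'
  rw [hcond]
  constructor
  · intro H u x
    let b : ContDiffBump ((x, 0) : (Fin ℓ → ℝ) × ℝ) := default
    have hX : (fun z => b z • ((u, 0) : (Fin ℓ → ℝ) × ℝ)) ∈ FoliationRn ℓ k := by
      refine (mem_foliationRn_iff hk).2
        ⟨b.contDiff.smul contDiff_const, b.hasCompactSupport.smul_right, fun x r _ => ?_⟩
      simp
    have hY := (mem_foliationRn_iff hk).1 (H.subset (Set.mem_image_of_mem _ hX))
    refine ((hY.2.2 x).comp ((contDiff_snd.comp hY.1).comp (hsec x)) (hvsec x) (hv0 x)).congr ?_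
    have hnear : ∀ᶠ y in 𝓝 (0 : ℝ), b (x, y) = 1 :=
      ((hsec x).continuous.tendsto 0).eventually b.eventuallyEq_one
    filter_upwards [hnear] with y hy
    have hinv : θinv (x, v (x, y)) = (x, y) := hli (x, y)
    simp [hinv, hDθ, hy]
  · intro H
    refine Set.Subset.antisymm ?_ fun Y hY => ?_
    · rintro _ ⟨X, hX, rfl⟩
      obtain ⟨hXs, hXc, hXf⟩ := (mem_foliationRn_iff hk).1 hX
      refine (mem_foliationRn_iff hk).2 ⟨hθ.pushforward hθinv hXs,
        hXc.pushforward hθ.continuous hθinv.continuous hli hri, fun x => ?_⟩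
      have hXsec := hXs.comp (hsec x)
      have hhor : FlatAtZero k (fun y => fderiv ℝ v (x, y) ((X (x, y)).1, 0)) :=
        FlatAtZero.fderiv_horizontal hv (fun u => H u x) (contDiff_fst.comp hXsec)
      have hDvsec := (contDiff_infty_iff_fderiv.1 hv).2.comp (hsec x)
      have hver := (hXf x).mul_left
        (hDvsec.clm_apply (contDiff_const (c := ((0 : Fin ℓ → ℝ), (1 : ℝ)))))
        (contDiff_snd.comp hXsec)
      have hflat : FlatAtZero k (fun y => fderiv ℝ v (x, y) (X (x, y))) := by
        simp only [fun y => hsplit (x, y) (X (x, y))]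
        exact hhor.add hver
          (hDvsec.clm_apply ((contDiff_fst.comp hXsec).prodMk contDiff_const))
          ((hDvsec.clm_apply contDiff_const).mul (contDiff_snd.comp hXsec))
      have hcomp := hflat.comp (hDvsec.clm_apply hXsec)
        (contDiff_snd.comp (hθinv.comp (hsec x))) (by simp [hθ0])
      convert hcomp using 2 with y
      have hinv : (x, (θinv (x, y)).2) = θinv (x, y) := Prod.ext (hθ1 (x, y)).symm rfl
      simp [hDθ, hinv]
    · obtain ⟨hYs, hYc, hYf⟩ := (mem_foliationRn_iff hk).1 hY
      have hXs := hθinv.pushforward hθ hYs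
      refine ⟨fun z => fderiv ℝ θinv (z.1, v z) (Y (z.1, v z)), (mem_foliationRn_iff hk).2
        ⟨hXs, hYc.pushforward hθinv.continuous hθ.continuous hri hli, fun x => ?_⟩, ?_⟩
      · have hXsec := hXs.comp (hsec x)
        have hhor : FlatAtZero k (fun y => fderiv ℝ v (x, y)
            ((fderiv ℝ θinv (x, v (x, y)) (Y (x, v (x, y)))).1, 0)) :=
          FlatAtZero.fderiv_horizontal hv (fun u => H u x) (contDiff_fst.comp hXsec)
        have hDvsec := (contDiff_infty_iff_fderiv.1 hv).2.comp (hsec x)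
        have hhors := hDvsec.clm_apply ((contDiff_fst.comp hXsec).prodMk
          (contDiff_const (c := (0 : ℝ))))
        have hYsec := contDiff_snd.comp (hYs.comp (hsec x))
        have hYv := (hYf x).comp hYsec (hvsec x) (hv0 x)
        have hdiff := hYv.add (hhor.mul_left (contDiff_const (c := (-1 : ℝ))) hhors)
          (hYsec.comp (hvsec x)) (contDiff_const.mul hhors)
        have hw : ContDiff ℝ (⊤ : ℕ∞)
            (fun y => (fderiv ℝ θinv (x, v (x, y)) ((0 : Fin ℓ → ℝ), (1 : ℝ))).2) :=
          contDiff_snd.comp (((contDiff_infty_iff_fderiv.1 hθinv).2.comp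
            (hθ.comp (hsec x))).clm_apply contDiff_const)
        convert hdiff.mul_left hw ((hYsec.comp (hvsec x)).add (contDiff_const.mul hhors))
          using 2 with y
        set a := fderiv ℝ θinv (x, v (x, y)) (Y (x, v (x, y))) with ha
        have hYa : (Y (x, v (x, y))).2 = fderiv ℝ v (x, y) a := by
          have hinv := fderiv_fderiv_of_leftInverse hdθinv hdθ hri (x, v (x, y)) (Y (x, v (x, y)))
          rw [show θinv (x, v (x, y)) = (x, y) from hli (x, y), ← ha, hDθ] at hinv
          exact (congrArg Prod.snd hinv).symm
        have hone : fderiv ℝ v (x, y) (0, 1) *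
            (fderiv ℝ θinv (x, v (x, y)) ((0 : Fin ℓ → ℝ), (1 : ℝ))).2 = 1 := by
          have hinv := fderiv_fderiv_of_leftInverse hdθ hdθinv hli (x, y) (0, 1)
          rw [hDθ, show (((0 : Fin ℓ → ℝ), (1 : ℝ)).1, fderiv ℝ v (x, y) (0, 1)) =
            fderiv ℝ v (x, y) (0, 1) • ((0 : Fin ℓ → ℝ), (1 : ℝ)) by simp, map_smul] at hinv
          simpa using congrArg Prod.snd hinv
        rw [hYa, hsplit (x, y) a]
        linear_combination (-a.2) * hone
      · funext z
        have hz : ((θinv z).1, v (θinv z)) = z := hri z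
        simp only [hz]
        exact fderiv_fderiv_of_leftInverse hdθinv hdθ hri z (Y z)
end

section
/- Let θ : ℝ → ℝ be a C^∞ diffeomorphism. Then θ_*(F^k_ℝ) = F^k_ℝ if and only if θ(0) = 0. -/
/-- The singular foliation `F^k_ℝ` of `ℝ`: smooth compactly supported vector fields (identified
with functions `X : ℝ → ℝ`) vanishing to order `k` at `0`. -/
def FoliationR (k : ℕ) : Set (ℝ → ℝ) :=
  {X | ContDiff ℝ (⊤ : ℕ∞) X ∧ HasCompactSupport X ∧
    ∀ r : ℕ, r ≤ k - 1 → iteratedDeriv r X 0 = 0}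

/-- Vanishing of all derivatives up to order `r` is preserved by composing with a smooth map and
multiplying by a smooth function. -/
theorem iteratedDeriv_mul_comp_eq_zero {φ : ℝ → ℝ} (hφ : ContDiff ℝ (⊤ : ℕ∞) φ) (a : ℝ) (r : ℕ) :
    ∀ {g X : ℝ → ℝ}, ContDiff ℝ (⊤ : ℕ∞) g → ContDiff ℝ (⊤ : ℕ∞) X →
      (∀ s ≤ r, iteratedDeriv s X (φ a) = 0) →
      iteratedDeriv r (fun z => g z * X (φ z)) a = 0 := by
  induction r with
  | zero =>
    intro g X _ _ h
    have := h 0 le_rfl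
    simp_all
  | succ r ih =>
    intro g X hg hX h
    have hdg : ContDiff ℝ (⊤ : ℕ∞) (deriv g) := (contDiff_infty_iff_deriv.1 hg).2
    have hdX : ContDiff ℝ (⊤ : ℕ∞) (deriv X) := (contDiff_infty_iff_deriv.1 hX).2
    have hdφ : ContDiff ℝ (⊤ : ℕ∞) (deriv φ) := (contDiff_infty_iff_deriv.1 hφ).2
    have hderiv : deriv (fun z => g z * X (φ z)) =
        (fun z => deriv g z * X (φ z)) + fun z => (g z * deriv φ z) * deriv X (φ z) := by
      funext z
      have h₁ := ((contDiff_infty_iff_deriv.1 hg).1 z).hasDerivAt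
      have h₂ := ((contDiff_infty_iff_deriv.1 hX).1 (φ z)).hasDerivAt
      have h₃ := ((contDiff_infty_iff_deriv.1 hφ).1 z).hasDerivAt
      have h₄ := (h₁.mul (h₂.comp z h₃)).deriv
      simp only [Pi.add_apply]
      refine h₄.trans ?_
      simp only [Function.comp_apply]
      ring
    have hle : ((r : ℕ) : WithTop ℕ∞) ≤ ((⊤ : ℕ∞) : WithTop ℕ∞) := by
      exact_mod_cast le_top
    have hs₁ : ContDiff ℝ (⊤ : ℕ∞) fun z => deriv g z * X (φ z) := hdg.mul (hX.comp hφ)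
    have hs₂ : ContDiff ℝ (⊤ : ℕ∞) fun z => (g z * deriv φ z) * deriv X (φ z) :=
      (hg.mul hdφ).mul (hdX.comp hφ)
    rw [iteratedDeriv_succ', hderiv, iteratedDeriv_add (hs₁.contDiffAt.of_le hle)
      (hs₂.contDiffAt.of_le hle), ih hdg hX fun s hs => h s (hs.trans r.le_succ),
      ih (hg.mul hdφ) hdX fun s hs => ?_, add_zero]
    rw [← iteratedDeriv_succ']
    exact h (s + 1) (Nat.succ_le_succ hs)

theorem deriv_mul_deriv_of_rightInverse {f g : ℝ → ℝ} (hf : ContDiff ℝ (⊤ : ℕ∞) f)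
    (hg : ContDiff ℝ (⊤ : ℕ∞) g) (h : Function.RightInverse g f) (z : ℝ) :
    deriv f (g z) * deriv g z = 1 := by
  have h₁ := ((contDiff_infty_iff_deriv.1 hf).1 (g z)).hasDerivAt
  have h₂ := ((contDiff_infty_iff_deriv.1 hg).1 z).hasDerivAt
  have h₃ := (h₁.comp z h₂).deriv
  rw [h.comp_eq_id] at h₃
  simpa using h₃.symm

/-- The pushforward along a diffeomorphism fixing `0` preserves `FoliationR k`. -/
theorem pushforward_mem_foliationR {k : ℕ} {f g : ℝ → ℝ} (hf : ContDiff ℝ (⊤ : ℕ∞) f)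
    (hg : ContDiff ℝ (⊤ : ℕ∞) g) (hl : Function.LeftInverse g f) (hr : Function.RightInverse g f)
    (h0 : g 0 = 0) {X : ℝ → ℝ} (hX : X ∈ FoliationR k) :
    (fun z => deriv f (g z) * X (g z)) ∈ FoliationR k := by
  obtain ⟨hXs, hXc, hXv⟩ := hX
  have hdf : ContDiff ℝ (⊤ : ℕ∞) (fun z => deriv f (g z)) :=
    (contDiff_infty_iff_deriv.1 hf).2.comp hg
  refine ⟨hdf.mul (hXs.comp hg), ?_, fun r hrk => ?_⟩
  · let e : ℝ ≃ₜ ℝ := ⟨⟨g, f, hr, hl⟩, hg.continuous, hf.continuous⟩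
    exact (hXc.comp_homeomorph e).mul_left
  · exact iteratedDeriv_mul_comp_eq_zero hg 0 r hdf hXs fun s hs => by
      rw [h0]
      exact hXv s (hs.trans hrk)

/-- Away from `0`, some element of `FoliationR k` does not vanish. -/
theorem exists_mem_foliationR_apply_eq_one (k : ℕ) {p : ℝ} (hp : p ≠ 0) :
    ∃ X ∈ FoliationR k, X p = 1 := by
  have hp' : 0 < |p| := abs_pos.2 hp
  let b : ContDiffBump p := ⟨|p| / 4, |p| / 2, by positivity, by linarith⟩
  refine ⟨b, ⟨b.contDiff, b.hasCompactSupport, fun r _ => ?_⟩,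
    b.one_of_mem_closedBall (Metric.mem_closedBall_self b.rIn_pos.le)⟩
  have h0 : (0 : ℝ) ∉ tsupport b := by
    rw [b.tsupport_eq, Metric.mem_closedBall, Real.dist_eq, zero_sub, abs_neg]
    change ¬ |p| ≤ |p| / 2
    linarith
  have := (notMem_tsupport_iff_eventuallyEq.1 h0).iteratedDeriv_eq r
  rw [this]
  simp

/-- A smooth diffeomorphism `θ` of `ℝ` satisfies `θ_*(F^k_ℝ) = F^k_ℝ`
if and only if `θ(0) = 0`. -/
theorem statement2 (k : ℕ) (hk : 1 ≤ k) (θ θinv : ℝ → ℝ)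
    (hθ : ContDiff ℝ (⊤ : ℕ∞) θ) (hθinv : ContDiff ℝ (⊤ : ℕ∞) θinv)
    (hli : Function.LeftInverse θinv θ) (hri : Function.RightInverse θinv θ) :
    ((fun X : ℝ → ℝ => fun z => deriv θ (θinv z) * X (θinv z)) '' FoliationR k = FoliationR k)
    ↔ θ 0 = 0 := by
  constructor
  · intro h
    by_contra h0
    have hp : θinv 0 ≠ 0 := fun hp => h0 (by simpa [hp] using hri 0)
    obtain ⟨X, hX, hX1⟩ := exists_mem_foliationR_apply_eq_one k hp
    have hv := (h.subset (Set.mem_image_of_mem _ hX)).2.2 0 (Nat.zero_le _)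
    have hd := deriv_mul_deriv_of_rightInverse hθ hθinv hri 0
    simp_all
  · intro h0
    have h0' : θinv 0 = 0 := by rw [← h0, hli 0, h0]
    apply Set.Subset.antisymm
    · rintro _ ⟨X, hX, rfl⟩
      exact pushforward_mem_foliationR hθ hθinv hli hri h0' hX
    · intro Y hY
      refine ⟨_, pushforward_mem_foliationR hθinv hθ hri hli h0 hY, ?_⟩
      funext z
      simp only [hri z]
      rw [← mul_assoc, deriv_mul_deriv_of_rightInverse hθ hθinv hri z, one_mul]
end

section
/- Let ℓ ≥ 1, n = ℓ+1, and let θ : ℝⁿ → ℝⁿ be a C^∞ diffeomorphism with θ(ℝ^ℓ × {0}) = ℝ^ℓ × {0}. Write θ = (θ¹, θ²) with θ¹ : ℝⁿ → ℝ^ℓ and θ² : ℝⁿ → ℝ. Then for every z₀ ∈ ℝ^ℓ × {0} there exists an open neighbourhood U of z₀ such that the vertical map θ_v(x,y) := (x, θ²(x,y)) restricts to a C^∞ diffeomorphism from U onto an open set V ⊆ ℝⁿ, and the composition θ ∘ (θ_v|_U)⁻¹ : V → ℝⁿ is horizontal, i.e. of the form (x,y) ↦ (h(x,y), y) for some smooth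 map h : V → ℝ^ℓ. -/
open Set

section VerticalMap

variable {E : Type*} [NormedAddCommGroup E] [NormedSpace ℝ E]

/-- The linear automorphism `(u, t) ↦ (u, φ (u, t))` of `E × ℝ`, for a functional `φ` that does
not vanish on the vertical direction. -/
noncomputable def verticalEquiv (φ : E × ℝ →L[ℝ] ℝ) (hφ : φ (0, 1) ≠ 0) :
    (E × ℝ) ≃L[ℝ] (E × ℝ) :=
  have split : ∀ (u : E) (t : ℝ), φ (u, t) = φ (u, 0) + t * φ (0, 1) := fun u t => by
    have h : ((u, t) : E × ℝ) = (u, 0) + t • (0, 1) := by ext <;> simp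
    rw [h, map_add, map_smul, smul_eq_mul]
  ContinuousLinearEquiv.equivOfInverse
    ((ContinuousLinearMap.fst ℝ E ℝ).prod φ)
    ((ContinuousLinearMap.fst ℝ E ℝ).prod ((φ (0, 1))⁻¹ • (ContinuousLinearMap.snd ℝ E ℝ -
      φ.comp ((ContinuousLinearMap.inl ℝ E ℝ).comp (ContinuousLinearMap.fst ℝ E ℝ)))))
    (by
      rintro ⟨u, t⟩
      ext
      · simp
      · simp [split u t]
        field_simp)
    (by
      rintro ⟨u, t⟩
      ext
      · simp
      · simp [split u ((φ (0, 1))⁻¹ * (t - φ (u, 0)))]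
        field_simp
        ring)

/-- The vertical derivative of the second component of a map with surjective derivative preserving the
hyperplane `E × {0}` does not vanish on that hyperplane. -/
theorem vertical_derivative_ne_zero {F : Type*} [NormedAddCommGroup F] [NormedSpace ℝ F]
    {θ : E × ℝ → F × ℝ} {D : E × ℝ →L[ℝ] F × ℝ} {z₀ : E × ℝ} (hD : HasFDerivAt θ D z₀)
    (hsurj : Function.Surjective D) (hz₀ : z₀.2 = 0) (hθ : ∀ z : E × ℝ, z.2 = 0 → (θ z).2 = 0) :
    (D (0, 1)).2 ≠ 0 := by
  intro hc
  have hflat : ∀ u : E, (D (u, 0)).2 = 0 := fun u => by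
    have hline : HasDerivAt (fun t : ℝ => z₀ + t • ((u, 0) : E × ℝ)) (u, 0) 0 := by
      simpa using ((hasDerivAt_id (0 : ℝ)).smul_const ((u, 0) : E × ℝ)).const_add z₀
    have hsnd : HasFDerivAt (fun z => (θ z).2) ((ContinuousLinearMap.snd ℝ F ℝ).comp D)
        (z₀ + (0 : ℝ) • ((u, 0) : E × ℝ)) := by
      simpa using hD.snd
    have hcomp := hsnd.comp_hasDerivAt (0 : ℝ) hline
    have hzero : (fun z => (θ z).2) ∘ (fun t : ℝ => z₀ + t • ((u, 0) : E × ℝ)) = fun _ => 0 := by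
      funext t
      exact hθ _ (by simp [hz₀])
    rw [hzero] at hcomp
    exact hcomp.unique (hasDerivAt_const _ _)
  obtain ⟨⟨u, s⟩, hw⟩ := hsurj (0, 1)
  have h : ((u, s) : E × ℝ) = (u, 0) + s • (0, 1) := by ext <;> simp
  have h2 := congrArg Prod.snd hw
  rw [h, map_add, map_smul] at h2
  simp [hflat, hc] at h2

end VerticalMap


/-- If `θ` is a smooth diffeomorphism of `ℝⁿ = ℝ^ℓ × ℝ` preserving the
hyperplane `ℝ^ℓ × {0}`, then near every point of the hyperplane we can write `θ = θ_h ∘ θ_v`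
with `θ_v(x,y) = (x, θ²(x,y))` vertical and `θ_h` horizontal: the vertical map `θ_v` restricts
to a diffeomorphism of a neighbourhood `U` onto an open set `V`, and `θ ∘ (θ_v|_U)⁻¹` is of
the form `(x,y) ↦ (h(x,y), y)` on `V`. -/
theorem statement3 (ℓ : ℕ) (hℓ : 1 ≤ ℓ)
    (θ θinv : ((Fin ℓ → ℝ) × ℝ) → ((Fin ℓ → ℝ) × ℝ))
    (hθ : ContDiff ℝ (⊤ : ℕ∞) θ) (hθinv : ContDiff ℝ (⊤ : ℕ∞) θinv)
    (hli : Function.LeftInverse θinv θ) (hri : Function.RightInverse θinv θ)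
    (hL : θ '' {z : (Fin ℓ → ℝ) × ℝ | z.2 = 0} = {z : (Fin ℓ → ℝ) × ℝ | z.2 = 0}) :
    ∀ z₀ : (Fin ℓ → ℝ) × ℝ, z₀.2 = 0 →
      ∃ (U V : Set ((Fin ℓ → ℝ) × ℝ)) (ψ : ((Fin ℓ → ℝ) × ℝ) → ((Fin ℓ → ℝ) × ℝ)),
        IsOpen U ∧ IsOpen V ∧ z₀ ∈ U ∧
        Set.BijOn (fun z : (Fin ℓ → ℝ) × ℝ => (z.1, (θ z).2)) U V ∧
        ContDiffOn ℝ (⊤ : ℕ∞) ψ V ∧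
        (∀ z ∈ U, ψ (z.1, (θ z).2) = z) ∧
        (∀ w ∈ V, ((ψ w).1, (θ (ψ w)).2) = w) ∧
        ∃ h : ((Fin ℓ → ℝ) × ℝ) → (Fin ℓ → ℝ),
          ContDiffOn ℝ (⊤ : ℕ∞) h V ∧ ∀ w ∈ V, θ (ψ w) = (h w, w.2) := by
  intro z₀ hz₀
  have hdiff : Differentiable ℝ θ := hθ.differentiable (by simp)
  set φ : ((Fin ℓ → ℝ) × ℝ) → ((Fin ℓ → ℝ) × ℝ →L[ℝ] ℝ) := fun z =>
    (ContinuousLinearMap.snd ℝ (Fin ℓ → ℝ) ℝ).comp (fderiv ℝ θ z)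
  have hsurj : Function.Surjective (fderiv ℝ θ z₀) := fun w => by
    have h1 : HasFDerivAt θinv (fderiv ℝ θinv (θ z₀)) (θ z₀) :=
      (hθinv.differentiable (by simp) _).hasFDerivAt
    have h2 : HasFDerivAt θ (fderiv ℝ θ z₀) (θinv (θ z₀)) := by
      rw [hli z₀]
      exact (hdiff z₀).hasFDerivAt
    have h3 := h2.comp (θ z₀) h1
    rw [hri.comp_eq_id] at h3
    exact ⟨fderiv ℝ θinv (θ z₀) w, DFunLike.congr_fun (h3.unique (hasFDerivAt_id _)) w⟩
  have hφ₀ : φ z₀ (0, 1) ≠ 0 :=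
    vertical_derivative_ne_zero (hdiff z₀).hasFDerivAt hsurj hz₀
      fun z hz => hL.subset (mem_image_of_mem θ hz)
  have hφ_cont : Continuous fun z => φ z (0, 1) :=
    ((hθ.continuous_fderiv (by simp)).clm_apply continuous_const).snd
  set θv : ((Fin ℓ → ℝ) × ℝ) → ((Fin ℓ → ℝ) × ℝ) := fun z => (z.1, (θ z).2)
  have hθv : ContDiff ℝ (⊤ : ℕ∞) θv := contDiff_fst.prodMk hθ.snd
  have hθv' : ∀ z (hz : φ z (0, 1) ≠ 0), HasFDerivAt θv
      (verticalEquiv (φ z) hz : (Fin ℓ → ℝ) × ℝ →L[ℝ] (Fin ℓ → ℝ) × ℝ) z := fun z hz =>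
    hasFDerivAt_fst.prodMk (hdiff z).hasFDerivAt.snd
  have hopen : IsOpen {z | φ z (0, 1) ≠ 0} := isOpen_ne_fun hφ_cont continuous_const
  set e := (hθv.contDiffAt.toOpenPartialHomeomorph θv (hθv' z₀ hφ₀) (by simp)).restrOpen
    {z | φ z (0, 1) ≠ 0} hopen
  have hψ : ContDiffOn ℝ (⊤ : ℕ∞) e.symm e.target := fun w hw =>
    (e.contDiffAt_symm hw (hθv' _ (e.map_target hw).2) hθv.contDiffAt).contDiffWithinAt
  refine ⟨e.source, e.target, e.symm, e.open_source, e.open_target,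
    ⟨hθv.contDiffAt.mem_toOpenPartialHomeomorph_source (hθv' z₀ hφ₀) (by simp), hφ₀⟩,
    e.bijOn, hψ, fun z hz => e.left_inv hz, fun w hw => e.right_inv hw,
    fun w => (θ (e.symm w)).1, (hθ.comp_contDiffOn hψ).fst, fun w hw => ?_⟩
  have hw' : θv (e.symm w) = w := e.right_inv hw
  exact Prod.ext rfl (congrArg Prod.snd hw' :)
end

section
/- Let k ≥ 2 be an integer and let θ₁, θ₂ : ℝ → ℝ be C^∞ diffeomorphisms with θ₁(0) = θ₂(0) = 0 whose (k−1)-jets at 0 differ, i.e. there exists r with 1 ≤ r ≤ k−1 such that θ₁^{(r)}(0) ≠ θ₂^{(r)}(0). For i = 1,2 let f_i : ℝ² → ℝ be the unique C^∞ function with θᵢ(y + t·y^k) = θᵢ(y) + f_i(t,y)·y^k for all (t,y), and set U_i := {(t,y) ∈ ℝ² : 1 + t·y^{k−1} > 0 and |y|^{1/2}·|f_i(t,y)| < 1}. Then there exists ε > 0 such that whenever (t₁,y) ∈ U₁, (t₂,y) ∈ U₂ and 0 < |y| < ε, one has θ₁(y + t₁·y^k) ≠ θ₂(y + t₂·y^k).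 -/
open Filter Topology in
/-- A smooth function whose `r`-th derivative at `0` does not vanish is bounded below near `0` by a
positive multiple of `|y| ^ r`. -/
theorem exists_pos_mul_abs_pow_le_of_iteratedDeriv_ne_zero {g : ℝ → ℝ}
    (hg : ContDiff ℝ (⊤ : ℕ∞) g) {r : ℕ} (hr : iteratedDeriv r g 0 ≠ 0) :
    ∃ c > (0 : ℝ), ∀ᶠ y in 𝓝 (0 : ℝ), c * |y| ^ r ≤ |g y| := by
  classical
  have hex : ∃ m, iteratedDeriv m g 0 ≠ 0 := ⟨r, hr⟩
  obtain ⟨m, hm, hmin⟩ : ∃ m, iteratedDeriv m g 0 ≠ 0 ∧ ∀ j < m, iteratedDeriv j g 0 = 0 :=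
    ⟨Nat.find hex, Nat.find_spec hex, fun j hj => not_not.mp (Nat.find_min hex hj)⟩
  have hmr : m ≤ r := not_lt.mp fun h => hr (hmin r h)
  have htaylor (y : ℝ) :
      taylorWithinEval g m Set.univ 0 y = (m.factorial : ℝ)⁻¹ * iteratedDeriv m g 0 * y ^ m := by
    rw [taylor_within_apply, Finset.sum_range_succ, Finset.sum_eq_zero]
    · simp only [iteratedDerivWithin_univ, sub_zero, smul_eq_mul]
      ring
    · intro j hj
      simp [iteratedDerivWithin_univ, hmin j (Finset.mem_range.mp hj)]
  set a : ℝ := (m.factorial : ℝ)⁻¹ * iteratedDeriv m g 0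
  have ha0 : 0 < |a| := abs_pos.mpr (mul_ne_zero (by positivity) hm)
  have hlittle := taylor_isLittleO_univ (x₀ := 0)
    (hg.of_le (by exact_mod_cast le_top) : ContDiff ℝ (m : ℕ) g)
  refine ⟨|a| / 2, half_pos ha0, ?_⟩
  filter_upwards [hlittle.bound (half_pos ha0), Metric.ball_mem_nhds (0 : ℝ) one_pos] with y hy hy1
  rw [mem_ball_zero_iff, Real.norm_eq_abs] at hy1
  rw [htaylor, sub_zero, Real.norm_eq_abs, Real.norm_eq_abs, abs_pow] at hy
  have hpow : |y| ^ r ≤ |y| ^ m := pow_le_pow_of_le_one (abs_nonneg y) hy1.le hmr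
  have htri : |a * y ^ m| ≤ |g y| + |g y - a * y ^ m| := by
    simpa using abs_sub (g y) (g y - a * y ^ m)
  rw [abs_mul, abs_pow] at htri
  nlinarith

/-- Let `θ₁, θ₂` be smooth diffeomorphisms of `ℝ` fixing `0` whose `(k-1)`-jets
at `0` differ, and let `f₁, f₂` be the associated smooth functions with
`θᵢ(y + t·y^k) = θᵢ(y) + fᵢ(t,y)·y^k`.  With
`Uᵢ = {(t,y) : 1 + t·y^{k-1} > 0 and √|y| · |fᵢ(t,y)| < 1}`, there is `ε > 0` such that for
`(t₁,y) ∈ U₁`, `(t₂,y) ∈ U₂` and `0 < |y| < ε` one has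
`θ₁(y + t₁·y^k) ≠ θ₂(y + t₂·y^k)`. -/
theorem statement5 (k : ℕ) (hk : 2 ≤ k)
    (θ₁ θ₂ θ₁inv θ₂inv : ℝ → ℝ)
    (hθ₁ : ContDiff ℝ (⊤ : ℕ∞) θ₁) (hθ₂ : ContDiff ℝ (⊤ : ℕ∞) θ₂)
    (hθ₁inv : ContDiff ℝ (⊤ : ℕ∞) θ₁inv) (hθ₂inv : ContDiff ℝ (⊤ : ℕ∞) θ₂inv)
    (h₁li : Function.LeftInverse θ₁inv θ₁) (h₁ri : Function.RightInverse θ₁inv θ₁)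
    (h₂li : Function.LeftInverse θ₂inv θ₂) (h₂ri : Function.RightInverse θ₂inv θ₂)
    (h₁0 : θ₁ 0 = 0) (h₂0 : θ₂ 0 = 0)
    (hjet : ∃ r : ℕ, 1 ≤ r ∧ r ≤ k - 1 ∧ iteratedDeriv r θ₁ 0 ≠ iteratedDeriv r θ₂ 0)
    (f₁ f₂ : ℝ × ℝ → ℝ)
    (hf₁ : ContDiff ℝ (⊤ : ℕ∞) f₁) (hf₂ : ContDiff ℝ (⊤ : ℕ∞) f₂)
    (hf₁eq : ∀ t y : ℝ, θ₁ (y + t * y ^ k) = θ₁ y + f₁ (t, y) * y ^ k)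
    (hf₂eq : ∀ t y : ℝ, θ₂ (y + t * y ^ k) = θ₂ y + f₂ (t, y) * y ^ k) :
    ∃ ε > (0 : ℝ), ∀ t₁ t₂ y : ℝ,
      (0 < 1 + t₁ * y ^ (k - 1) ∧ Real.sqrt |y| * |f₁ (t₁, y)| < 1) →
      (0 < 1 + t₂ * y ^ (k - 1) ∧ Real.sqrt |y| * |f₂ (t₂, y)| < 1) →
      0 < |y| → |y| < ε →
      θ₁ (y + t₁ * y ^ k) ≠ θ₂ (y + t₂ * y ^ k) := by
  obtain ⟨r, -, hrk, hr⟩ := hjet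
  have hg : iteratedDeriv r (θ₁ - θ₂) 0 ≠ 0 := by
    have h₁ : ContDiff ℝ (r : ℕ) θ₁ := hθ₁.of_le (by exact_mod_cast le_top)
    have h₂ : ContDiff ℝ (r : ℕ) θ₂ := hθ₂.of_le (by exact_mod_cast le_top)
    rw [iteratedDeriv_sub h₁.contDiffAt h₂.contDiffAt]
    exact sub_ne_zero.mpr hr
  obtain ⟨c, hc, hev⟩ := exists_pos_mul_abs_pow_le_of_iteratedDeriv_ne_zero (hθ₁.sub hθ₂) hg
  obtain ⟨δ, hδ, hball⟩ := Metric.eventually_nhds_iff.mp hev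
  refine ⟨min δ (min 1 ((c / 2) ^ 2)), by positivity, ?_⟩
  rintro t₁ t₂ y ⟨-, hU₁⟩ ⟨-, hU₂⟩ hy0 hyε heq
  obtain ⟨hyδ, hy1, hyc⟩ : |y| < δ ∧ |y| < 1 ∧ |y| < (c / 2) ^ 2 := by
    simpa only [lt_min_iff] using hyε
  have hlow : c * |y| ^ r ≤ |θ₁ y - θ₂ y| := hball (by simpa using hyδ)
  have hpow : |y| ^ (k - 1) ≤ |y| ^ r := pow_le_pow_of_le_one hy0.le hy1.le hrk
  have hk1 : |y| ^ k = |y| ^ (k - 1) * |y| := by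
    rw [← pow_succ, Nat.sub_add_cancel (by omega)]
  have hdiff : |θ₁ y - θ₂ y| ≤ (|f₁ (t₁, y)| + |f₂ (t₂, y)|) * (|y| ^ (k - 1) * |y|) := by
    rw [hf₁eq, hf₂eq] at heq
    have hsub : θ₁ y - θ₂ y = (f₂ (t₂, y) - f₁ (t₁, y)) * y ^ k := by linarith
    rw [hsub, abs_mul, abs_pow, ← hk1, add_comm]
    gcongr
    exact abs_sub _ _
  have hp : 0 < |y| ^ (k - 1) := by positivity
  have hcle : c ≤ (|f₁ (t₁, y)| + |f₂ (t₂, y)|) * |y| := by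
    refine le_of_mul_le_mul_right ?_ hp
    nlinarith
  have hs : √|y| < c / 2 := (Real.sqrt_lt' (half_pos hc)).mpr hyc
  have hs0 : 0 < √|y| := Real.sqrt_pos.mpr hy0
  have hsq : √|y| * √|y| = |y| := Real.mul_self_sqrt hy0.le
  have hlt : (|f₁ (t₁, y)| + |f₂ (t₂, y)|) * |y| < 2 * √|y| := by
    calc (|f₁ (t₁, y)| + |f₂ (t₂, y)|) * |y|
        = (√|y| * |f₁ (t₁, y)| + √|y| * |f₂ (t₂, y)|) * √|y| := by
          linear_combination -(|f₁ (t₁, y)| + |f₂ (t₂, y)|) * hsq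
      _ < 2 * √|y| := by gcongr; linarith
  linarith
end

section
/- Let H be a group and let P and Q be nonempty sets, each equipped with a free and transitive left H-action. Let Λ denote the set of functions λ : Q × P → H satisfying λ(k•q, h•p) = k·λ(q,p)·h⁻¹ for all h, k ∈ H, p ∈ P, q ∈ Q, and let H act diagonally on Q × P by h•(q,p) = (h•q, h•p). Then: (1) for each λ ∈ Λ, the orbit of the pair (q, λ(q,p)•p) in the orbit space (Q × P)/H is independent of the choice of p ∈ P and q ∈ Q; and (2) the resulting map sending λ to this orbit is a bijection from Λ onto (Q × P)/H. -/
/-- In a free action, a group element is determined by its effect on a single point. -/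
theorem smul_right_injective_of_free {H S : Type*} [Group H] [MulAction H S]
    (hfree : ∀ (h : H) (s : S), h • s = s → h = 1) (s : S) :
    Function.Injective fun h : H => h • s := by
  intro a b hab
  have hab : a • s = b • s := hab
  have h1 : b⁻¹ * a = 1 := hfree _ s (by rw [mul_smul, hab, inv_smul_smul])
  exact (inv_mul_eq_one.mp h1).symm

/-- For a group `H` acting freely and transitively on nonempty sets `P` and
`Q`, let `Λ` be the set of maps `λ : Q × P → H` with `λ(k•q, h•p) = k·λ(q,p)·h⁻¹`.  Then
`⟦(q, λ(q,p)•p)⟧` in the orbit space `(Q × P)/H` (diagonal action) does not depend on `p, q`,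
and `λ ↦ ⟦(q₀, λ(q₀,p₀)•p₀)⟧` is a bijection from `Λ` onto `(Q × P)/H`. -/
theorem statement14 {H P Q : Type*} [Group H] [Nonempty P] [Nonempty Q]
    [MulAction H P] [MulAction H Q]
    (hPfree : ∀ (h : H) (p : P), h • p = p → h = 1)
    (hPtrans : ∀ p p' : P, ∃ h : H, h • p = p')
    (hQfree : ∀ (h : H) (q : Q), h • q = q → h = 1)
    (hQtrans : ∀ q q' : Q, ∃ h : H, h • q = q')
    (Λ : Set (Q × P → H))
    (hΛ : ∀ l : Q × P → H,
      l ∈ Λ ↔ ∀ (h k : H) (p : P) (q : Q), l (k • q, h • p) = k * l (q, p) * h⁻¹) :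
    (∀ l ∈ Λ, ∀ (p p' : P) (q q' : Q),
        Quotient.mk (MulAction.orbitRel H (Q × P)) (q, l (q, p) • p)
          = Quotient.mk (MulAction.orbitRel H (Q × P)) (q', l (q', p') • p'))
    ∧
    (∀ (p₀ : P) (q₀ : Q),
      Set.BijOn
        (fun l : Q × P → H =>
          Quotient.mk (MulAction.orbitRel H (Q × P)) (q₀, l (q₀, p₀) • p₀))
        Λ Set.univ) := by
  refine ⟨fun l hl p p' q q' => ?_, fun p₀ q₀ => ⟨fun _ _ => Set.mem_univ _, ?_, ?_⟩⟩
  · obtain ⟨h, rfl⟩ := hPtrans p p'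
    obtain ⟨k, rfl⟩ := hQtrans q q'
    refine Eq.symm (Quotient.sound ⟨k, ?_⟩)
    simp [(hΛ l).mp hl h k p q, mul_smul]
  · intro l hl m hm hlm
    obtain ⟨h, hh⟩ := Quotient.exact hlm
    obtain ⟨hq, hp⟩ := Prod.ext_iff.mp hh
    obtain rfl : h = 1 := hQfree h q₀ hq
    have hbase : l (q₀, p₀) = m (q₀, p₀) :=
      smul_right_injective_of_free hPfree p₀ (by simpa using hp.symm)
    funext ⟨q, p⟩
    obtain ⟨h, rfl⟩ := hPtrans p₀ p
    obtain ⟨k, rfl⟩ := hQtrans q₀ q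
    rw [(hΛ l).mp hl, (hΛ m).mp hm, hbase]
  · rintro x -
    obtain ⟨⟨q, p⟩, rfl⟩ := Quotient.exists_rep x
    obtain ⟨k, hk⟩ := hQtrans q q₀
    obtain ⟨a, ha⟩ := hPtrans p₀ (k • p)
    choose f hf using hPtrans p₀
    choose g hg using hQtrans q₀
    have hf_smul (h : H) (p : P) : f (h • p) = h * f p :=
      smul_right_injective_of_free hPfree p₀ (by simp [mul_smul, hf])
    have hg_smul (h : H) (q : Q) : g (h • q) = h * g q :=
      smul_right_injective_of_free hQfree q₀ (by simp [mul_smul, hg])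
    refine ⟨fun y => g y.1 * a * (f y.2)⁻¹, (hΛ _).mpr fun h k p q => ?_,
      Quotient.sound ⟨k, ?_⟩⟩
    · simp only [hf_smul, hg_smul]
      group
    · simp [hPfree _ _ (hf p₀), hQfree _ _ (hg q₀), hk, ha]
end
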